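/- For s ≥ 2, every w ∈ N_{s,3}(2143) satisfies w_1 = 3s−2, and exactly one of the following five conditions holds: (i) (w_2,w_3) = (3s−1, 3s); (ii) (w_2,w_3,w_4) = (3s−1, 3s−5, 3s); (iii) (w_2,w_3,w_4) = (3s−5, 3s−1, 3s); (iv) (w_2,w_3,w_4,w_5) = (3s−5, 3s−1, 3s−4, 3s); (v) (w_2,w_3,w_4,w_5) = (3s−1, 3s−5, 3s−4, 3s). -/

import Mathlib

open Polynomial

/-- `σ ∈ S_n` contains the pattern `τ ∈ S_m`. -/
def PermContains {n m : ℕ} (σ : Equiv.Perm (Fin n)) (τ : Equiv.Perm (Fin m)) : Prop :=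
  ∃ f : Fin m → Fin n, StrictMono f ∧ ∀ j k : Fin m, σ (f j) < σ (f k) ↔ τ j < τ k

/-- The pattern `1243` (0-indexed). -/
def pat1243 : Equiv.Perm (Fin 4) := ⟨![0, 1, 3, 2], ![0, 1, 3, 2], by decide, by decide⟩

/-- The pattern `2143` (0-indexed). -/
def pat2143 : Equiv.Perm (Fin 4) := ⟨![1, 0, 3, 2], ![1, 0, 3, 2], by decide, by decide⟩

/-- `w ∈ S_{st}` (a word recorded as a permutation of `Fin (s*t)`, positions and labels both
0-indexed, 0-indexed label `a` standing for the poset label `a+1`) encodes a linear extension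
of the rectangular poset `N_{s,t}`: for every label `a ∈ [st]`, if `t ∤ a` then `a` appears
before `a+1`, and if `a > t` then `a` appears before `a−t`.  ("`a` appears before `b`" means
`w.symm a < w.symm b`.) -/
def IsLinExtN (s t : ℕ) (w : Equiv.Perm (Fin (s * t))) : Prop :=
  (∀ a b : Fin (s * t), (b : ℕ) = (a : ℕ) + 1 → ¬ (t ∣ ((a : ℕ) + 1)) →
      w.symm a < w.symm b) ∧
  (∀ a b : Fin (s * t), (b : ℕ) + t = (a : ℕ) → w.symm a < w.symm b)

/-- The number of inversions of `w`. -/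
def invCount {n : ℕ} (w : Equiv.Perm (Fin n)) : ℕ :=
  (Finset.univ.filter fun p : Fin n × Fin n => p.1 < p.2 ∧ w p.2 < w p.1).card

open Classical in
/-- The polynomial `N_{s,t}(τ)(q) = Σ_{w ∈ N_{s,t}(τ)} q^{inv(w)}`. -/
noncomputable def NPoly (s t : ℕ) {m : ℕ} (τ : Equiv.Perm (Fin m)) : Polynomial ℤ :=
  ∑ w ∈ Finset.univ.filter
      (fun w : Equiv.Perm (Fin (s * t)) => IsLinExtN s t w ∧ ¬ PermContains w τ),
    (X : Polynomial ℤ) ^ invCount w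

/-- Exactly one of five pairwise exclusive, jointly exhaustive propositions holds. -/
theorem existsUnique_vec_five {a b c d e : Prop} (h : a ∨ b ∨ c ∨ d ∨ e)
    (ha : a → ¬ b ∧ ¬ c ∧ ¬ d ∧ ¬ e) (hb : b → ¬ c ∧ ¬ d ∧ ¬ e) (hc : c → ¬ d ∧ ¬ e)
    (hd : d → ¬ e) : ∃! i : Fin 5, ![a, b, c, d, e] i := by
  refine existsUnique_of_exists_of_unique ?_ ?_
  · rcases h with h | h | h | h | h
    exacts [⟨0, h⟩, ⟨1, h⟩, ⟨2, h⟩, ⟨3, h⟩, ⟨4, h⟩]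
  · intro i j hi hj
    fin_cases i <;> fin_cases j <;> simp at hi hj ⊢ <;> tauto

/-- If positions `P` on the labels below `3 * s` increase along each block of three labels and
decrease under adding `3`, the first label of a block precedes every label of that block and of
the blocks of smaller labels. -/
theorem block_head_le {s : ℕ} {P : ℕ → ℕ}
    (hsucc : ∀ a, a + 1 < 3 * s → ¬ 3 ∣ a + 1 → P a < P (a + 1))
    (hthree : ∀ a, a + 3 < 3 * s → P (a + 3) < P a)
    {r : ℕ} (hr : r < s) {a : ℕ} (ha : a < 3 * r + 3) : P (3 * r) ≤ P a := by
  have column : ∀ d k, k + d = r → P (3 * r) ≤ P (3 * k) := by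
    intro d
    induction d with
    | zero => intro k hk; rw [show k = r by omega]
    | succ d ih =>
      intro k hk
      exact (ih (k + 1) (by omega)).trans (hthree (3 * k) (by omega)).le
  have hcol := column (r - a / 3) (a / 3) (by omega)
  have h0 : a = 3 * (a / 3) ∨ a = 3 * (a / 3) + 1 ∨ a = 3 * (a / 3) + 1 + 1 := by omega
  have h1 := fun h => hsucc (3 * (a / 3)) h (by omega)
  have h2 := fun h => hsucc (3 * (a / 3) + 1) h (by omega)
  rcases h0 with h | h | h
  · rwa [← h] at hcol
  · rw [h]
    exact hcol.trans (h1 (by omega)).le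
  · rw [h]
    exact hcol.trans ((h1 (by omega)).trans (h2 (by omega))).le

/-- Four positions carrying values in the relative order `2143` give an occurrence of `2143`. -/
theorem permContains_pat2143 {n : ℕ} {w : Equiv.Perm (Fin n)} {a b c d : Fin n}
    (hab : w.symm a < w.symm b) (hbc : w.symm b < w.symm c) (hcd : w.symm c < w.symm d)
    (hba : b < a) (had : a < d) (hdc : d < c) : PermContains w pat2143 := by
  refine ⟨![w.symm a, w.symm b, w.symm c, w.symm d], ?_, ?_⟩
  · rw [Fin.strictMono_iff_lt_succ]
    intro i
    fin_cases i
    exacts [hab, hbc, hcd]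
  · intro j k
    fin_cases j <;> fin_cases k <;> simp [pat2143] <;> order

/-- If the only labels at positions `0, …, 4` up to the position `a₃` of `3 * m + 6` are the five
listed ones, the order constraints on their positions leave five initial segments. -/
theorem initial_entries_of_positions {m a₁ a₂ a₃ b₁ b₂ : ℕ} {W : ℕ → ℕ} (h₁ : a₁ = 0)
    (h₂ : a₂ < a₃) (hb : b₁ < b₂) (hab : a₂ < b₂) (h12 : 0 < a₂ ∧ 0 < b₁)
    (n₂ : b₁ ≠ a₂) (n₃ : b₁ ≠ a₃) (n₄ : b₂ ≠ a₃)
    (hcases : ∀ j, j < 5 →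
      (W (j + 1) = 3 * m + 1 ∧ b₁ = j) ∨ (W (j + 1) = 3 * m + 2 ∧ b₂ = j) ∨
      (W (j + 1) = 3 * m + 4 ∧ a₁ = j) ∨ (W (j + 1) = 3 * m + 5 ∧ a₂ = j) ∨
      (W (j + 1) = 3 * m + 6 ∧ a₃ = j) ∨ a₃ < j) :
    (W 2 = 3 * m + 5 ∧ W 3 = 3 * m + 6) ∨
    (W 2 = 3 * m + 5 ∧ W 3 = 3 * m + 1 ∧ W 4 = 3 * m + 6) ∨
    (W 2 = 3 * m + 1 ∧ W 3 = 3 * m + 5 ∧ W 4 = 3 * m + 6) ∨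
    (W 2 = 3 * m + 1 ∧ W 3 = 3 * m + 5 ∧ W 4 = 3 * m + 2 ∧ W 5 = 3 * m + 6) ∨
    (W 2 = 3 * m + 5 ∧ W 3 = 3 * m + 1 ∧ W 4 = 3 * m + 2 ∧ W 5 = 3 * m + 6) := by
  have h1 := hcases 1 (by omega)
  have hpos : (a₂ = 1 ∧ a₃ = 2) ∨ (a₂ = 1 ∧ b₁ = 2 ∧ a₃ = 3) ∨ (b₁ = 1 ∧ a₂ = 2 ∧ a₃ = 3) ∨
      (b₁ = 1 ∧ a₂ = 2 ∧ b₂ = 3 ∧ a₃ = 4) ∨ (a₂ = 1 ∧ b₁ = 2 ∧ b₂ = 3 ∧ a₃ = 4) := by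
    have h2 : b₁ = 2 ∨ b₂ = 2 ∨ a₂ = 2 ∨ a₃ ≤ 2 := by have := hcases 2 (by omega); omega
    have h3 : b₁ = 3 ∨ b₂ = 3 ∨ a₂ = 3 ∨ a₃ ≤ 3 := by have := hcases 3 (by omega); omega
    have h4 : b₁ = 4 ∨ b₂ = 4 ∨ a₂ = 4 ∨ a₃ ≤ 4 := by have := hcases 4 (by omega); omega
    replace h1 : b₁ = 1 ∨ a₂ = 1 := by omega
    omega
  have h2 := hcases 2 (by omega)
  have h3 := hcases 3 (by omega)
  have h4 := hcases 4 (by omega)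
  simp only [Nat.reduceAdd] at h1 h2 h3 h4
  rcases hpos with h | h | h | h | h
  · left; omega
  · right; left; omega
  · right; right; left; omega
  · right; right; right; left; omega
  · right; right; right; right; omega

/-- For `s ≥ 2`, every `w ∈ N_{s,3}(2143)` starts with `w_1 = 3s−2`, and exactly one of five
conditions on its next entries holds.  Here `W j` denotes the `j`-th (1-indexed) entry of `w`
as a 1-indexed label, i.e. `W (j+1) = w(j) + 1` for the 0-indexed position `j`. -/
theorem initial_entries_s_three_2143 (s : ℕ) (hs : 2 ≤ s)
    (w : Equiv.Perm (Fin (s * 3))) (hlin : IsLinExtN s 3 w) (hav : ¬ PermContains w pat2143)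
    (W : ℕ → ℕ) (hW : ∀ (j : ℕ) (h : j < s * 3), W (j + 1) = (w ⟨j, h⟩ : ℕ) + 1) :
    W 1 = 3 * s - 2 ∧
    ∃! i : Fin 5,
      ![W 2 = 3 * s - 1 ∧ W 3 = 3 * s,
        W 2 = 3 * s - 1 ∧ W 3 = 3 * s - 5 ∧ W 4 = 3 * s,
        W 2 = 3 * s - 5 ∧ W 3 = 3 * s - 1 ∧ W 4 = 3 * s,
        W 2 = 3 * s - 5 ∧ W 3 = 3 * s - 1 ∧ W 4 = 3 * s - 4 ∧ W 5 = 3 * s,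
        W 2 = 3 * s - 1 ∧ W 3 = 3 * s - 5 ∧ W 4 = 3 * s - 4 ∧ W 5 = 3 * s] i := by
  obtain ⟨hsucc, hthree⟩ := hlin
  let P : ℕ → ℕ := fun a => if h : a < s * 3 then (w.symm ⟨a, h⟩ : ℕ) else 0
  have hP : ∀ a (h : a < s * 3), P a = (w.symm ⟨a, h⟩ : ℕ) := fun a h => dif_pos h
  have hPsucc : ∀ a, a + 1 < 3 * s → ¬ 3 ∣ a + 1 → P a < P (a + 1) := by
    intro a h h3
    rw [hP a (by omega), hP (a + 1) (by omega)]
    exact hsucc _ _ rfl h3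
  have hPthree : ∀ a, a + 3 < 3 * s → P (a + 3) < P a := by
    intro a h
    rw [hP a (by omega), hP (a + 3) (by omega)]
    exact hthree _ _ rfl
  have hPinj : ∀ a b, a < 3 * s → b < 3 * s → P a = P b → a = b := by
    intro a b ha hb h
    rw [hP a (by omega), hP b (by omega)] at h
    simpa using w.symm.injective (Fin.ext h)
  obtain ⟨m, rfl⟩ : ∃ m, s = m + 2 := ⟨s - 2, by omega⟩
  have hfirst : ∀ a, a < 3 * m + 6 → P (3 * m + 3) ≤ P a := fun a ha =>
    block_head_le hPsucc hPthree (r := m + 1) (by omega) (by omega)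
  have hlate : ∀ a, a < 3 * m → P (3 * m + 5) < P a := by
    intro a ha
    by_contra hle
    have h1 : P (3 * m) ≤ P a := block_head_le hPsucc hPthree (by omega) (by omega)
    have h2 := hPthree (3 * m + 2) (by omega)
    have n1 := hPinj (3 * m) a (by omega) (by omega)
    have n2 := hPinj (3 * m + 5) a (by omega) (by omega)
    have h3 : P (3 * m) < P a := by omega
    have h4 : P a < P (3 * m + 5) := by omega
    rw [hP _ (by omega), hP _ (by omega)] at h2 h3 h4
    refine hav (permContains_pat2143 h3 h4 h2 ?_ ?_ ?_) <;> simp only [Fin.lt_def] <;> omega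
  have hA12 : P (3 * m + 3) < P (3 * m + 4) := hPsucc (3 * m + 3) (by omega) (by omega)
  have hA23 : P (3 * m + 4) < P (3 * m + 5) := hPsucc (3 * m + 4) (by omega) (by omega)
  have hB12 : P (3 * m) < P (3 * m + 1) := hPsucc (3 * m) (by omega) (by omega)
  have hAB2 : P (3 * m + 4) < P (3 * m + 1) := hPthree (3 * m + 1) (by omega)
  have hAB3 : P (3 * m + 5) < P (3 * m + 2) := hPthree (3 * m + 2) (by omega)
  have hentry : ∀ j, j < 5 → ∃ a, a < 3 * m + 6 ∧ W (j + 1) = a + 1 ∧ P a = j := by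
    intro j hj
    refine ⟨w ⟨j, by omega⟩, ?_, hW j (by omega), ?_⟩
    · have := (w ⟨j, by omega⟩).isLt
      omega
    · rw [hP _ (w ⟨j, by omega⟩).isLt]
      simp
  have hcases : ∀ j, j < 5 →
      (W (j + 1) = 3 * m + 1 ∧ P (3 * m) = j) ∨
      (W (j + 1) = 3 * m + 2 ∧ P (3 * m + 1) = j) ∨
      (W (j + 1) = 3 * m + 4 ∧ P (3 * m + 3) = j) ∨
      (W (j + 1) = 3 * m + 5 ∧ P (3 * m + 4) = j) ∨
      (W (j + 1) = 3 * m + 6 ∧ P (3 * m + 5) = j) ∨ P (3 * m + 5) < j := by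
    intro j hj
    obtain ⟨a, ha, hWa, hPa⟩ := hentry j hj
    by_cases hlt : a < 3 * m
    · have := hlate a hlt
      omega
    · obtain ⟨i, rfl⟩ := Nat.exists_eq_add_of_le (not_lt.mp hlt)
      have hi : i < 6 := by omega
      interval_cases i <;> (try rw [Nat.add_zero] at hWa hPa) <;> omega
  have hfB := hfirst (3 * m) (by omega)
  have hz : P (3 * m + 3) = 0 ∧ W 1 = 3 * m + 4 := by
    obtain ⟨a, ha, hWa, hPa⟩ := hentry 0 (by omega)
    have hle := hfirst a ha
    have := hPinj a (3 * m + 3) (by omega) (by omega) (by omega)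
    subst this
    exact ⟨hPa, hWa⟩
  have n13 : P (3 * m) ≠ P (3 * m + 3) := fun h => by
    have := hPinj _ _ (by omega) (by omega) h
    omega
  have n14 : P (3 * m) ≠ P (3 * m + 4) := fun h => by
    have := hPinj _ _ (by omega) (by omega) h
    omega
  have n15 : P (3 * m) ≠ P (3 * m + 5) := fun h => by
    have := hPinj _ _ (by omega) (by omega) h
    omega
  have n25 : P (3 * m + 1) ≠ P (3 * m + 5) := fun h => by
    have := hPinj _ _ (by omega) (by omega) h
    omega
  refine ⟨by omega, ?_⟩
  have key := initial_entries_of_positions (by omega) hA23 hB12 hAB2 (by omega) n14 n15 n25 hcases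
  rw [show 3 * (m + 2) - 1 = 3 * m + 5 by omega, show 3 * (m + 2) = 3 * m + 6 by omega,
    show 3 * m + 6 - 5 = 3 * m + 1 by omega, show 3 * m + 6 - 4 = 3 * m + 2 by omega]
  refine existsUnique_vec_five key ?_ ?_ ?_ ?_ <;> omega
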